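/- Let K ⊂ ℝⁿ be an isotropic convex body with isotropy parameter M_K and isotropy constant L_K = M_K/|K|^{(n+2)/(2n)}, and let (D_m)_{m≥1} be Borel subsets of ℝⁿ with D_m ⊂ K, |D_m| > 0, |D_m| → 0, such that K'_m := K \ D_m is a convex body for every m. Then there exist C > 0 and m₀ such that for all m ≥ m₀: | L_{K'_m}^{2n} − L_K^{2n} [ 1 − (∫_{K\K'_m} |X|² dX)/M_K² + (n+2)|K\K'_m|/|K| ] | ≤ C L_K^{2n} |K\K'_m|². -/

import Mathlib

open MeasureTheory Metric Set Filter
open scoped InnerProductSpace Topology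

noncomputable section

/-- A convex body in ℝⁿ: a compact convex set with nonempty interior. -/
def IsConvexBody {n : ℕ} (K : Set (EuclideanSpace ℝ (Fin n))) : Prop :=
  IsCompact K ∧ Convex ℝ K ∧ (interior K).Nonempty

/-- The centroid of a set. -/
def centroid {n : ℕ} (K : Set (EuclideanSpace ℝ (Fin n))) : EuclideanSpace ℝ (Fin n) :=
  ((volume K).toReal)⁻¹ • ∫ x in K, x

/-- `(1/n!) ∫_{A}⋯∫_{A} det(X₁ − g, …, Xₙ − g)² dX₁ ⋯ dXₙ`. -/
def detInt {n : ℕ} (A : Set (EuclideanSpace ℝ (Fin n))) (g : EuclideanSpace ℝ (Fin n)) : ℝ :=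
  ((n.factorial : ℝ))⁻¹ *
    ∫ X in Set.univ.pi (fun _ : Fin n => A),
      (Matrix.det (Matrix.of fun i j : Fin n => X j i - g i)) ^ 2
      ∂(Measure.pi fun _ : Fin n => volume)

/-- `M_K^{2n}`, the 2n-th power of the isotropy parameter of a convex body. -/
def Mpow2n {n : ℕ} (K : Set (EuclideanSpace ℝ (Fin n))) : ℝ := detInt K (centroid K)

/-- The isotropy constant `L_K = M_K / |K|^{(n+2)/(2n)}` of a convex body. -/
def isoL (n : ℕ) (K : Set (EuclideanSpace ℝ (Fin n))) : ℝ :=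
  (Mpow2n K) ^ ((2 * (n : ℝ)))⁻¹ / (volume K).toReal ^ (((n : ℝ) + 2) / (2 * n))

/-- `K` is isotropic with isotropy parameter `M`. -/
def IsIsotropic {n : ℕ} (K : Set (EuclideanSpace ℝ (Fin n))) (M : ℝ) : Prop :=
  0 < M ∧ (∫ x in K, x) = 0 ∧
    ∀ y : EuclideanSpace ℝ (Fin n), (∫ x in K, (⟪x, y⟫_ℝ) ^ 2) = M ^ 2 * ‖y‖ ^ 2

/-- `(N, q)` witnesses positive generalized Gauss curvature of `K` at `X₀`. -/
def CurvWitness {n : ℕ} (K : Set (EuclideanSpace ℝ (Fin n))) (X₀ N : EuclideanSpace ℝ (Fin n))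
    (q : QuadraticForm ℝ (EuclideanSpace ℝ (Fin n))) : Prop :=
  ‖N‖ = 1 ∧ (∀ x ∈ K, 0 ≤ ⟪x - X₀, N⟫_ℝ) ∧
  (∀ Y : EuclideanSpace ℝ (Fin n), ⟪Y, N⟫_ℝ = 0 → Y ≠ 0 → 0 < q Y) ∧
  ∀ ε > (0 : ℝ), ∃ a > (0 : ℝ), ∀ (Y : EuclideanSpace ℝ (Fin n)) (y : ℝ), ⟪Y, N⟫_ℝ = 0 →
    X₀ + Y + y • N ∈ frontier K ∩ Metric.ball X₀ a →
    (1 - ε) * q Y ≤ y ∧ y ≤ (1 + ε) * q Y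

/-- `K` has positive generalized Gauss curvature at `X₀`. -/
def HasPosGenCurvature {n : ℕ} (K : Set (EuclideanSpace ℝ (Fin n)))
    (X₀ : EuclideanSpace ℝ (Fin n)) : Prop :=
  ∃ N q, CurvWitness K X₀ N q

/-- `K` is a local maximizer for the isotropy constant (Hausdorff distance). -/
def IsLocalMaxIso {n : ℕ} (K : Set (EuclideanSpace ℝ (Fin n))) : Prop :=
  ∃ ε > (0 : ℝ), ∀ K' : Set (EuclideanSpace ℝ (Fin n)), IsConvexBody K' →
    hausdorffDist K' K < ε → isoL n K' ≤ isoL n K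

/-- `K` is a local minimizer for the isotropy constant (Hausdorff distance). -/
def IsLocalMinIso {n : ℕ} (K : Set (EuclideanSpace ℝ (Fin n))) : Prop :=
  ∃ ε > (0 : ℝ), ∀ K' : Set (EuclideanSpace ℝ (Fin n)), IsConvexBody K' →
    hausdorffDist K' K < ε → isoL n K ≤ isoL n K'

/-- `X₀` is a point of local strict convexity of `∂K`. -/
def IsLocalStrictConvexPoint {n : ℕ} (K : Set (EuclideanSpace ℝ (Fin n)))
    (X₀ : EuclideanSpace ℝ (Fin n)) : Prop :=
  X₀ ∈ frontier K ∧
    ¬ ∃ A B : EuclideanSpace ℝ (Fin n), A ≠ B ∧ segment ℝ A B ⊆ frontier K ∧ X₀ ∈ segment ℝ A B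

open Asymptotics

theorem detInt_eq_det {n : ℕ} (A : Set (EuclideanSpace ℝ (Fin n)))
    (hA : IsCompact A) (g : EuclideanSpace ℝ (Fin n)) :
    detInt A g = Matrix.det (Matrix.of fun i j : Fin n =>
      ∫ x in A, (x i - g i) * (x j - g j)) := by
  unfold detInt
  rw [Measure.restrict_pi_pi]
  have hint : ∀ i j : Fin n, Integrable (fun x : EuclideanSpace ℝ (Fin n) =>
      (x i - g i) * (x j - g j)) (volume.restrict A) := fun i j =>
    ContinuousOn.integrableOn_compact hA (by fun_prop)
  have hexp : ∀ X : Fin n → EuclideanSpace ℝ (Fin n),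
      (Matrix.det (Matrix.of fun i j : Fin n => X j i - g i)) ^ 2 =
      ∑ τ : Equiv.Perm (Fin n), ∑ σ : Equiv.Perm (Fin n),
        (((Equiv.Perm.sign τ : ℤ) : ℝ) * ((Equiv.Perm.sign σ : ℤ) : ℝ)) *
          ∏ j, ((X j (σ j) - g (σ j)) * (X j (τ j) - g (τ j))) := by
    intro X
    rw [sq, Matrix.det_apply', Finset.sum_mul_sum]
    refine Finset.sum_congr rfl fun τ _ => Finset.sum_congr rfl fun σ _ => ?_
    rw [Finset.prod_mul_distrib]
    simp only [Matrix.of_apply]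
    ring
  have hprod : ∀ σ τ : Equiv.Perm (Fin n), Integrable
      (fun X : Fin n → EuclideanSpace ℝ (Fin n) =>
        ∏ j, ((X j (σ j) - g (σ j)) * (X j (τ j) - g (τ j))))
      (Measure.pi fun _ : Fin n => volume.restrict A) := fun σ τ =>
    Integrable.fintype_prod (f := fun j (x : EuclideanSpace ℝ (Fin n)) =>
      (x (σ j) - g (σ j)) * (x (τ j) - g (τ j))) fun j => hint _ _
  simp_rw [hexp]
  rw [integral_finsetSum _ fun τ _ => integrable_finsetSum _ fun σ _ =>
    (hprod σ τ).const_mul _]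
  set S : Matrix (Fin n) (Fin n) ℝ := Matrix.of fun i j : Fin n =>
      ∫ x in A, (x i - g i) * (x j - g j) with hS
  have hτ : ∀ τ : Equiv.Perm (Fin n),
      (∫ X : Fin n → EuclideanSpace ℝ (Fin n), ∑ σ : Equiv.Perm (Fin n),
        (((Equiv.Perm.sign τ : ℤ) : ℝ) * ((Equiv.Perm.sign σ : ℤ) : ℝ)) *
          ∏ j, ((X j (σ j) - g (σ j)) * (X j (τ j) - g (τ j)))
        ∂(Measure.pi fun _ : Fin n => volume.restrict A)) = S.det := by
    intro τ
    rw [integral_finsetSum _ fun σ _ => (hprod σ τ).const_mul _]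
    have : ∀ σ : Equiv.Perm (Fin n), (∫ X : Fin n → EuclideanSpace ℝ (Fin n),
        (((Equiv.Perm.sign τ : ℤ) : ℝ) * ((Equiv.Perm.sign σ : ℤ) : ℝ)) *
          ∏ j, ((X j (σ j) - g (σ j)) * (X j (τ j) - g (τ j)))
        ∂(Measure.pi fun _ : Fin n => volume.restrict A)) =
        ((Equiv.Perm.sign τ : ℤ) : ℝ) * (((Equiv.Perm.sign σ : ℤ) : ℝ) *
          ∏ j, S.submatrix id τ (σ j) j) := by
      intro σ
      rw [integral_const_mul, integral_fintype_prod_eq_prod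
        (f := fun j (x : EuclideanSpace ℝ (Fin n)) =>
          (x (σ j) - g (σ j)) * (x (τ j) - g (τ j)))]
      simp [hS, mul_assoc]
    simp_rw [this]
    rw [← Finset.mul_sum, ← Matrix.det_apply', Matrix.det_permute', ← mul_assoc]
    have : (((Equiv.Perm.sign τ : ℤ) : ℝ) * ((Equiv.Perm.sign τ : ℤ) : ℝ)) = 1 := by
      rcases Int.units_eq_one_or (Equiv.Perm.sign τ) with h | h <;> simp [h]
    rw [this, one_mul]
  simp_rw [hτ]
  have : (n.factorial : ℝ) ≠ 0 := by positivity
  simp [Fintype.card_perm, this]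

theorem isBigO_prod_one_add_sub {ι α : Type*} {l : Filter α} {v : α → ℝ}
    (hv : Tendsto v l (𝓝 0)) (s : Finset ι) (a : ι → α → ℝ)
    (ha : ∀ i ∈ s, a i =O[l] v) :
    (fun m => ∏ i ∈ s, (1 + a i m) - 1 - ∑ i ∈ s, a i m) =O[l] fun m => v m ^ 2 := by
  classical
  have hv1 : v =O[l] fun _ => (1 : ℝ) := hv.isBigO_one ℝ
  induction s using Finset.induction_on with
  | empty => simpa using isBigO_zero _ _
  | insert i s hi ih =>
    have h1 := ih fun j hj => ha j (Finset.mem_insert_of_mem hj)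
    have hai := ha i (Finset.mem_insert_self _ _)
    have hs : (fun m => ∑ j ∈ s, a j m) =O[l] v :=
      IsBigO.fun_sum fun j hj => ha j (Finset.mem_insert_of_mem hj)
    have h2 := ((isBigO_refl (fun _ : α => (1 : ℝ)) l).add (hai.trans hv1)).mul h1
    have h3 := hai.mul hs
    simp only [one_mul, ← sq] at h2 h3
    refine (h2.add h3).congr_left fun m => ?_
    rw [Finset.prod_insert hi, Finset.sum_insert hi]
    ring

theorem isBigO_det_one_add_sub {ι α : Type*} [Fintype ι] [DecidableEq ι] {l : Filter α}
    {v : α → ℝ} (hv : Tendsto v l (𝓝 0)) (E : α → Matrix ι ι ℝ)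
    (hE : ∀ i j, (fun m => E m i j) =O[l] v) :
    (fun m => (1 + E m).det - 1 - (E m).trace) =O[l] fun m => v m ^ 2 := by
  have hv1 : v =O[l] fun _ => (1 : ℝ) := hv.isBigO_one ℝ
  have hdiag := isBigO_prod_one_add_sub hv Finset.univ (fun i m => E m i i) fun i _ => hE i i
  have hone : ∀ i j, (fun m => (1 + E m) i j) =O[l] fun _ => (1 : ℝ) := fun i j =>
    (isBigO_const_const _ one_ne_zero _).add ((hE i j).trans hv1)
  have hoff : ∀ i j, i ≠ j → (fun m => (1 + E m) i j) =O[l] v := fun i j h =>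
    (hE i j).congr_left fun m => by simp [h]
  have hsum : (fun m => ∑ σ ∈ Finset.univ.erase (1 : Equiv.Perm ι),
      ((Equiv.Perm.sign σ : ℤ) : ℝ) * ∏ i, (1 + E m) (σ i) i) =O[l] fun m => v m ^ 2 := by
    refine IsBigO.fun_sum fun σ hσ => IsBigO.const_mul_left ?_ _
    obtain ⟨i, hi⟩ : ∃ i, σ i ≠ i := by
      by_contra! h
      exact Finset.ne_of_mem_erase hσ (Equiv.ext h)
    have hi' : σ (σ i) ≠ σ i := fun h => hi (σ.injective h)
    have hmem : σ i ∈ Finset.univ.erase i := Finset.mem_erase.2 ⟨hi, Finset.mem_univ _⟩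
    have hrest : (fun m => ∏ k ∈ (Finset.univ.erase i).erase (σ i), (1 + E m) (σ k) k)
        =O[l] fun _ => (1 : ℝ) := by
      simpa using IsBigO.finsetProd (s := (Finset.univ.erase i).erase (σ i))
        (g := fun _ _ => (1 : ℝ)) fun k _ => hone (σ k) k
    refine ((hoff _ _ hi).mul ((hoff _ _ hi').mul hrest)).congr (fun m => ?_) fun m => by ring
    rw [Finset.mul_prod_erase _ (fun k => (1 + E m) (σ k) k) hmem,
      Finset.mul_prod_erase _ (fun k => (1 + E m) (σ k) k) (Finset.mem_univ i)]
  refine (hdiag.add hsum).congr_left fun m => ?_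
  rw [Matrix.det_apply', ← Finset.add_sum_erase _ _ (Finset.mem_univ (1 : Equiv.Perm ι))]
  simp [Matrix.trace]
  ring

theorem isBigO_div_sub_pow_sub {α : Type*} {l : Filter α} {v : α → ℝ}
    (hv : Tendsto v l (𝓝 0)) {V : ℝ} (hV : 0 < V) (k : ℕ) :
    (fun m => (V / (V - v m)) ^ k - 1 - k * v m / V) =O[l] fun m => v m ^ 2 := by
  have hsub : Tendsto (fun m => V - v m) l (𝓝 V) := by simpa using hv.const_sub V
  have hinv : (fun m => (V - v m)⁻¹) =O[l] fun _ => (1 : ℝ) := (hsub.inv₀ hV.ne').isBigO_one ℝ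
  have ha : (fun m => v m * (V - v m)⁻¹) =O[l] v := by
    simpa using (isBigO_refl v l).mul hinv
  have h1 := isBigO_prod_one_add_sub hv (Finset.univ : Finset (Fin k))
    (fun _ m => v m * (V - v m)⁻¹) fun _ _ => ha
  have h2 : (fun m => k * V⁻¹ * (v m ^ 2 * (V - v m)⁻¹)) =O[l] fun m => v m ^ 2 := by
    refine IsBigO.const_mul_left ?_ _
    simpa using (isBigO_refl (fun m => v m ^ 2) l).mul hinv
  refine (h1.add h2).congr' ?_ EventuallyEq.rfl
  filter_upwards [hsub.eventually_ne hV.ne'] with m hm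
  have : 1 + v m * (V - v m)⁻¹ = V / (V - v m) := by field_simp; ring
  simp only [this, Finset.prod_const, Finset.sum_const, Finset.card_univ, Fintype.card_fin,
    nsmul_eq_mul]
  field_simp
  ring

theorem isBigO_mul_sub_one_sub {α : Type*} {l : Filter α} {v p q f g : α → ℝ}
    (hv : Tendsto v l (𝓝 0)) (hp : p =O[l] v) (hq : q =O[l] v)
    (hf : (fun m => f m - 1 - p m) =O[l] fun m => v m ^ 2)
    (hg : (fun m => g m - 1 - q m) =O[l] fun m => v m ^ 2) :
    (fun m => f m * g m - 1 - (p m + q m)) =O[l] fun m => v m ^ 2 := by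
  have hv1 : v =O[l] fun _ => (1 : ℝ) := hv.isBigO_one ℝ
  have hv2 : (fun m => v m ^ 2) =O[l] fun _ => (1 : ℝ) := by simpa using hv1.pow 2
  have one : (fun _ => (1 : ℝ)) =O[l] fun _ : α => (1 : ℝ) := isBigO_refl _ _
  have h1 := (hp.mul hq).congr_right fun m => (sq (v m)).symm
  have h2 := hf.mul ((hg.trans hv2).add (one.add (hq.trans hv1)))
  have h3 := hg.mul (one.add (hp.trans hv1))
  simp only [mul_one] at h2 h3
  exact (h1.add (h2.add h3)).congr_left fun m => by ring

theorem integral_mul_coord_of_isIsotropic {n : ℕ} {K : Set (EuclideanSpace ℝ (Fin n))} {M : ℝ}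
    (hK : IsCompact K) (h : IsIsotropic K M) (i j : Fin n) :
    ∫ x in K, x i * x j = if i = j then M ^ 2 else 0 := by
  obtain ⟨-, -, h⟩ := h
  have e : ∀ i j : Fin n, ∀ x : EuclideanSpace ℝ (Fin n), x i * x j =
      4⁻¹ * (⟪x, EuclideanSpace.single i (1 : ℝ) + EuclideanSpace.single j 1⟫_ℝ ^ 2 -
        ⟪x, EuclideanSpace.single i (1 : ℝ) - EuclideanSpace.single j 1⟫_ℝ ^ 2) := by
    intro i j x
    simp only [inner_add_right, inner_sub_right, EuclideanSpace.inner_single_right]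
    simp
    ring
  simp_rw [e]
  rw [integral_const_mul, integral_sub (ContinuousOn.integrableOn_compact hK (by fun_prop))
    (ContinuousOn.integrableOn_compact hK (by fun_prop)), h, h, norm_add_sq_real,
    norm_sub_sq_real]
  simp only [EuclideanSpace.inner_single_right]
  by_cases hij : i = j
  · simp [hij]; ring
  · simp [hij, Ne.symm hij]

theorem integral_coord {n : ℕ} {K : Set (EuclideanSpace ℝ (Fin n))}
    (hK : IsCompact K) (i : Fin n) : (∫ x in K, x) i = ∫ x in K, x i :=
  ((EuclideanSpace.proj i : EuclideanSpace ℝ (Fin n) →L[ℝ] ℝ).integral_comp_comm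
    (ContinuousOn.integrableOn_compact hK continuousOn_id)).symm

/-- The centered second moments of `K \ D` for isotropic `K`. -/
theorem centered_moment_diff {n : ℕ} {K D : Set (EuclideanSpace ℝ (Fin n))} {M : ℝ}
    (hK : IsCompact K) (hiso : IsIsotropic K M) (hD : MeasurableSet D) (hsub : D ⊆ K)
    (hKD : IsCompact (K \ D)) (hpos : volume.real (K \ D) ≠ 0) (i j : Fin n) :
    ∫ x in K \ D, (x i - centroid (K \ D) i) * (x j - centroid (K \ D) j) =
      (if i = j then M ^ 2 else 0) - ((∫ x in D, x i * x j) +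
        (∫ x in D, x i) * (∫ x in D, x j) / volume.real (K \ D)) := by
  have hc : ∀ i, centroid (K \ D) i = -(∫ x in D, x i) / volume.real (K \ D) := by
    intro i
    have h0 : ∫ x in K, x i = 0 := by rw [← integral_coord hK, hiso.2.1]; rfl
    simp only [centroid, PiLp.smul_apply, integral_coord hKD, smul_eq_mul]
    rw [setIntegral_sdiff hD (ContinuousOn.integrableOn_compact hK (by fun_prop)) hsub, h0,
      ← measureReal_def]
    ring
  have hI : ∀ i, ∫ x in K \ D, x i = -(∫ x in D, x i) := by
    intro i
    have h0 : ∫ x in K, x i = 0 := by rw [← integral_coord hK, hiso.2.1]; rfl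
    rw [setIntegral_sdiff hD (ContinuousOn.integrableOn_compact hK (by fun_prop)) hsub, h0,
      zero_sub]
  have hIJ : ∫ x in K \ D, x i * x j = (if i = j then M ^ 2 else 0) - ∫ x in D, x i * x j := by
    rw [setIntegral_sdiff hD (ContinuousOn.integrableOn_compact hK (by fun_prop)) hsub,
      integral_mul_coord_of_isIsotropic hK hiso]
  have hint : ∀ f : EuclideanSpace ℝ (Fin n) → ℝ, Continuous f →
      Integrable f (volume.restrict (K \ D)) := fun f hf =>
    ContinuousOn.integrableOn_compact hKD hf.continuousOn
  set g := centroid (K \ D) with hg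
  have hexp : ∀ x : EuclideanSpace ℝ (Fin n), (x i - g i) * (x j - g j) =
      ((x i * x j - g i * x j) - g j * x i) + g i * g j := fun x => by ring
  simp_rw [hexp]
  rw [integral_add (hint _ (by fun_prop)) (hint _ (by fun_prop)),
    integral_sub (hint _ (by fun_prop)) (hint _ (by fun_prop)),
    integral_sub (hint _ (by fun_prop)) (hint _ (by fun_prop)),
    integral_const_mul, integral_const_mul, hI, hI, hIJ, setIntegral_const, hc, hc]
  simp only [smul_eq_mul]
  field_simp
  ring

theorem IsConvexBody.measureReal_pos {n : ℕ} {K : Set (EuclideanSpace ℝ (Fin n))}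
    (hK : IsConvexBody K) : 0 < volume.real K :=
  ENNReal.toReal_pos (Measure.measure_pos_of_nonempty_interior _ hK.2.2).ne' hK.1.measure_lt_top.ne

theorem div_rpow_pow_two_mul {n : ℕ} (hn : n ≠ 0) (a : ℝ) {V : ℝ} (hV : 0 ≤ V) :
    (a / V ^ (((n : ℝ) + 2) / (2 * n))) ^ (2 * n) = a ^ (2 * n) / V ^ (n + 2) := by
  have hn' : (n : ℝ) ≠ 0 := by exact_mod_cast hn
  rw [div_pow, ← Real.rpow_mul_natCast hV]
  congr 1
  rw [← Real.rpow_natCast]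
  congr 1
  push_cast
  field_simp

theorem isoL_pow {n : ℕ} (hn : n ≠ 0) (K : Set (EuclideanSpace ℝ (Fin n))) :
    isoL n K ^ (2 * n) = Mpow2n K / volume.real K ^ (n + 2) := by
  have h0 : 0 ≤ Mpow2n K :=
    mul_nonneg (by positivity) (integral_nonneg fun _ => sq_nonneg _)
  rw [isoL, div_rpow_pow_two_mul hn _ ENNReal.toReal_nonneg, ← measureReal_def]
  congr 1
  have : (2 * (n : ℝ)) = ((2 * n : ℕ) : ℝ) := by push_cast; rfl
  rw [this, Real.rpow_inv_natCast_pow h0 (by omega)]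

/-- For isotropic `K`, the matrix `E` such that the second-moment matrix of `K \ D` about its
centroid is `M ^ 2 • (1 + E)`. -/
def momentPerturbation {n : ℕ} (K D : Set (EuclideanSpace ℝ (Fin n))) (M : ℝ) :
    Matrix (Fin n) (Fin n) ℝ :=
  Matrix.of fun i j => -(M ^ 2)⁻¹ * ((∫ x in D, x i * x j) +
    (∫ x in D, x i) * (∫ x in D, x j) * (volume.real (K \ D))⁻¹)

theorem Mpow2n_diff {n : ℕ} {K D : Set (EuclideanSpace ℝ (Fin n))} {M : ℝ}
    (hK : IsCompact K) (hiso : IsIsotropic K M) (hD : MeasurableSet D) (hsub : D ⊆ K)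
    (hKD : IsConvexBody (K \ D)) :
    Mpow2n (K \ D) = M ^ (2 * n) * (1 + momentPerturbation K D M).det := by
  have hM : M ≠ 0 := hiso.1.ne'
  rw [Mpow2n, detInt_eq_det _ hKD.1, pow_mul]
  have hsmul := Matrix.det_smul (1 + momentPerturbation K D M) (M ^ 2)
  rw [Fintype.card_fin] at hsmul
  rw [← hsmul]
  congr 1
  ext i j
  simp only [Matrix.of_apply]
  rw [centered_moment_diff hK hiso hD hsub hKD.1 hKD.measureReal_pos.ne']
  simp only [Matrix.smul_apply, Matrix.add_apply, Matrix.one_apply, momentPerturbation,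
    Matrix.of_apply, smul_eq_mul]
  split_ifs <;> field_simp <;> ring

theorem isBigO_setIntegral {n : ℕ} {K : Set (EuclideanSpace ℝ (Fin n))} (hK : IsCompact K)
    {α : Type*} {l : Filter α} {D : α → Set (EuclideanSpace ℝ (Fin n))} (hsub : ∀ m, D m ⊆ K)
    {f : EuclideanSpace ℝ (Fin n) → ℝ} (hf : Continuous f) :
    (fun m => ∫ x in D m, f x) =O[l] fun m => volume.real (D m) := by
  obtain ⟨C, hC⟩ := hK.exists_bound_of_continuousOn hf.continuousOn
  refine IsBigO.of_bound C (Eventually.of_forall fun m => ?_)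
  rw [Real.norm_of_nonneg measureReal_nonneg]
  exact norm_setIntegral_le_of_norm_le_const
    ((measure_mono (hsub m)).trans_lt hK.measure_lt_top) fun x hx => hC x (hsub m hx)

theorem sum_integral_mul_self {n : ℕ} {K D : Set (EuclideanSpace ℝ (Fin n))} (hK : IsCompact K)
    (hsub : D ⊆ K) : ∑ i, ∫ x in D, x i * x i = ∫ x in D, ‖x‖ ^ 2 := by
  rw [← integral_finsetSum _ fun i _ => (ContinuousOn.integrableOn_compact hK
    (by fun_prop)).mono_set hsub]
  simp_rw [EuclideanSpace.real_norm_sq_eq, sq]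

/-- **Proposition 4, inner case (Meyer–Reisner).** Asymptotic expansion of
`L_{K'_m}^{2n}` for `K'_m = K \ D_m`. -/
theorem isoL_pow_diff_inner_sets {n : ℕ} (K : Set (EuclideanSpace ℝ (Fin n))) (M : ℝ)
    (hK : IsConvexBody K) (hiso : IsIsotropic K M)
    (D : ℕ → Set (EuclideanSpace ℝ (Fin n)))
    (hmeas : ∀ m, MeasurableSet (D m))
    (hsub : ∀ m, D m ⊆ K)
    (hpos : ∀ m, 0 < volume (D m))
    (hto0 : Tendsto (fun m => volume (D m)) atTop (𝓝 0))
    (hconv : ∀ m, IsConvexBody (K \ D m)) :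
    ∃ c > (0 : ℝ), ∃ m₀ : ℕ, ∀ m ≥ m₀,
      |(isoL n (K \ D m)) ^ (2 * n)
          - (M / (volume K).toReal ^ (((n : ℝ) + 2) / (2 * n))) ^ (2 * n) *
            (1 - (∫ x in K \ (K \ D m), ‖x‖ ^ 2) / M ^ 2
              + ((n : ℝ) + 2) * (volume (K \ (K \ D m))).toReal / (volume K).toReal)|
        ≤ c * (M / (volume K).toReal ^ (((n : ℝ) + 2) / (2 * n))) ^ (2 * n) *
            ((volume (K \ (K \ D m))).toReal) ^ 2 := by
  rcases Nat.eq_zero_or_pos n with rfl | hn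
  · exfalso
    obtain ⟨x, hx⟩ := nonempty_of_measure_ne_zero (hpos 0).ne'
    obtain ⟨y, hy⟩ := (hconv 0).2.2
    exact (interior_subset hy).2 (Subsingleton.elim x y ▸ hx)
  obtain ⟨hKc, -, -⟩ := id hK
  have hV : 0 < volume.real K := hK.measureReal_pos
  have hM : 0 < M := hiso.1
  have hv : Tendsto (fun m => volume.real (D m)) atTop (𝓝 0) := by
    simpa [measureReal_def, Function.comp_def] using (ENNReal.tendsto_toReal ENNReal.zero_ne_top).comp hto0
  have hW : ∀ m, volume.real (K \ D m) = volume.real K - volume.real (D m) := fun m =>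
    measureReal_sdiff (hsub m) (hmeas m) hKc.measure_lt_top.ne
  have hsubt : Tendsto (fun m => volume.real (K \ D m)) atTop (𝓝 (volume.real K)) := by
    simpa [hW] using hv.const_sub (volume.real K)
  have hinv : (fun m => (volume.real (K \ D m))⁻¹) =O[atTop] fun _ => (1 : ℝ) :=
    (hsubt.inv₀ hV.ne').isBigO_one ℝ
  have hv1 : (fun m => volume.real (D m)) =O[atTop] fun _ => (1 : ℝ) := hv.isBigO_one ℝ
  have hb : ∀ i j : Fin n, (fun m => (∫ x in D m, x i) * (∫ x in D m, x j) *
      (volume.real (K \ D m))⁻¹) =O[atTop] fun m => volume.real (D m) ^ 2 := fun i j =>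
    (((isBigO_setIntegral hKc hsub (by fun_prop)).mul
      (isBigO_setIntegral hKc hsub (by fun_prop))).mul hinv).congr_right fun m => by ring
  have hv2 : (fun m => volume.real (D m) ^ 2) =O[atTop] fun m => volume.real (D m) := by
    simpa [sq] using (isBigO_refl (fun m => volume.real (D m)) atTop).mul hv1
  have hE : ∀ i j, (fun m => momentPerturbation K (D m) M i j) =O[atTop]
      fun m => volume.real (D m) := fun i j =>
    IsBigO.const_mul_left ((isBigO_setIntegral hKc hsub (by fun_prop)).add
      ((hb i j).trans hv2)) _
  have htr : ∀ m, (momentPerturbation K (D m) M).trace = -(∫ x in D m, ‖x‖ ^ 2) / M ^ 2 +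
      -(M ^ 2)⁻¹ * ∑ i, (∫ x in D m, x i) * (∫ x in D m, x i) * (volume.real (K \ D m))⁻¹ := by
    intro m
    rw [← sum_integral_mul_self hKc (hsub m)]
    simp only [momentPerturbation, Matrix.trace, Matrix.diag_apply, Matrix.of_apply]
    rw [← Finset.mul_sum, Finset.sum_add_distrib]
    ring
  have hdet : (fun m => (1 + momentPerturbation K (D m) M).det - 1 -
      -(∫ x in D m, ‖x‖ ^ 2) / M ^ 2) =O[atTop] fun m => volume.real (D m) ^ 2 := by
    have hsum : (fun m => -(M ^ 2)⁻¹ * ∑ i, (∫ x in D m, x i) * (∫ x in D m, x i) *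
        (volume.real (K \ D m))⁻¹) =O[atTop] fun m => volume.real (D m) ^ 2 :=
      IsBigO.const_mul_left (IsBigO.fun_sum fun i _ => hb i i) _
    refine ((isBigO_det_one_add_sub hv _ hE).add hsum).congr_left fun m => ?_
    rw [htr]
    ring
  have hp : (fun m => -(∫ x in D m, ‖x‖ ^ 2) / M ^ 2) =O[atTop]
      fun m => volume.real (D m) :=
    ((isBigO_setIntegral hKc hsub (f := fun x => ‖x‖ ^ 2) (by fun_prop)).const_mul_left (-(M ^ 2)⁻¹)).congr_left
      fun m => by ring
  have hq : (fun m => ((n + 2 : ℕ) : ℝ) * volume.real (D m) / volume.real K) =O[atTop]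
      fun m => volume.real (D m) :=
    ((isBigO_refl _ _).const_mul_left (((n + 2 : ℕ) : ℝ) / volume.real K)).congr_left
      fun m => by ring
  obtain ⟨c, hc, hbound⟩ := (isBigO_mul_sub_one_sub hv hp hq hdet
    (isBigO_div_sub_pow_sub hv hV (n + 2))).exists_pos
  obtain ⟨m₀, hm₀⟩ := eventually_atTop.1 hbound.bound
  refine ⟨c, hc, m₀, fun m hm => ?_⟩
  have key := hm₀ m hm
  rw [sdiff_sdiff_cancel_left (hsub m), isoL_pow hn.ne', Mpow2n_diff hKc hiso (hmeas m) (hsub m)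
    (hconv m), div_rpow_pow_two_mul hn.ne' _ ENNReal.toReal_nonneg]
  simp only [← measureReal_def]
  have hWpos := (hconv m).measureReal_pos
  rw [hW] at hWpos ⊢
  set V := volume.real K
  set v := volume.real (D m)
  have hL : 0 < M ^ (2 * n) / V ^ (n + 2) := by positivity
  rw [Real.norm_eq_abs, Real.norm_of_nonneg (sq_nonneg v)] at key
  have hfac : M ^ (2 * n) * (1 + momentPerturbation K (D m) M).det / (V - v) ^ (n + 2) -
      M ^ (2 * n) / V ^ (n + 2) * (1 - (∫ x in D m, ‖x‖ ^ 2) / M ^ 2 + ((n : ℝ) + 2) * v / V) =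
      M ^ (2 * n) / V ^ (n + 2) * ((1 + momentPerturbation K (D m) M).det *
        (V / (V - v)) ^ (n + 2) - 1 - (-(∫ x in D m, ‖x‖ ^ 2) / M ^ 2 +
          ((n + 2 : ℕ) : ℝ) * v / V)) := by
    rw [div_pow]
    push_cast
    field_simp
    ring
  rw [hfac, abs_mul, abs_of_pos hL]
  calc _ ≤ M ^ (2 * n) / V ^ (n + 2) * (c * v ^ 2) := by gcongr
    _ = _ := by ring
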